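/- arXiv:cs/0610054 — 3 statements merged into one kernel-verified Lean document; each statement's English description precedes it below -/
import Mathlib

section
/- For every natural number n, H₀₁(n) = Σ_{k=0}^{n} C(n,k) · 2 · H(k), where H₀₁(n) is the number of meet-closed subsets of Fin n → Bool, H(k) is the number of meet-closed subsets of Fin k → Bool containing both the all-false and the all-true vector, and C(n,k) is the binomial coefficient. (This is the paper's identity H₀₁(n) = Σ_k C(n,k)·H₀(k), using H₀(k) = 2·H(k).) -/
/-- A set of Boolean vectors is meet-closed if it is closed under
pointwise conjunction. -/
def MeetClosed {n : ℕ} (S : Set (Fin n → Bool)) : Prop :=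
  ∀ v ∈ S, ∀ w ∈ S, (fun i => v i && w i) ∈ S

/-- `H k` is the number of meet-closed subsets of `Fin k → Bool` containing
both the all-false and the all-true vector. -/
noncomputable def H (k : ℕ) : ℕ :=
  Nat.card {S : Set (Fin k → Bool) //
    MeetClosed S ∧ (fun _ => false) ∈ S ∧ (fun _ => true) ∈ S}

/-- A meet-closed set is determined by whether it contains the all-true vector and by the
meet-closed set obtained from it by adjoining that vector. -/
noncomputable def meetClosedEquivBoolProd (n : ℕ) :
    {S : Set (Fin n → Bool) // MeetClosed S} ≃
      Bool × {S : Set (Fin n → Bool) // MeetClosed S ∧ (fun _ => true) ∈ S} where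
  toFun S := (by classical exact decide ((fun _ => true) ∈ S.1), ⟨insert (fun _ => true) S.1, by
    refine ⟨?_, Set.mem_insert _ _⟩
    rintro v (rfl | hv) w (rfl | hw)
    · exact Or.inl (by simp)
    · exact Or.inr (by simpa using hw)
    · exact Or.inr (by simpa using hv)
    · exact Or.inr (S.2 v hv w hw)⟩)
  invFun p := ⟨{v | v ∈ p.2.1 ∧ (p.1 = true ∨ v ≠ fun _ => true)}, by
    rintro v ⟨hv, hv'⟩ w ⟨hw, hw'⟩
    refine ⟨p.2.2.1 v hv w hw, ?_⟩
    rcases hv' with h | h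
    · exact Or.inl h
    · refine Or.inr fun hvw => h (funext fun i => ?_)
      have := congrFun hvw i
      simp only [Bool.and_eq_true] at this
      exact this.1⟩
  left_inv S := by
    ext v
    by_cases hv : v = fun _ => true
    · subst hv
      simp
    · simp [hv]
  right_inv p := by
    obtain ⟨b, S, hS, ht⟩ := p
    refine Prod.ext ?_ (Subtype.ext (Set.ext fun v => ?_))
    · cases b <;> simp [ht]
    · by_cases hv : v = fun _ => true
      · subst hv
        simp [ht]
      · simpa [hv] using fun h _ => h

/-- The coordinates at which some vector of `S` is false. -/
noncomputable def falseSupport {n : ℕ} (S : Set (Fin n → Bool)) : Finset (Fin n) := by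
  classical exact Finset.univ.filter fun i => ∃ v ∈ S, v i = false

theorem mem_falseSupport {n : ℕ} {S : Set (Fin n → Bool)} {i : Fin n} :
    i ∈ falseSupport S ↔ ∃ v ∈ S, v i = false := by
  simp [falseSupport]

theorem MeetClosed.exists_forall_eq_false {n : ℕ} {S : Set (Fin n → Bool)} (hS : MeetClosed S)
    (hne : S.Nonempty) (B : Finset (Fin n)) (hB : B ⊆ falseSupport S) :
    ∃ m ∈ S, ∀ i ∈ B, m i = false := by
  induction B using Finset.induction_on with
  | empty => exact hne.imp fun m hm => ⟨hm, by simp⟩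
  | insert a B _ ih =>
    rw [Finset.insert_subset_iff] at hB
    obtain ⟨m, hm, hmB⟩ := ih hB.2
    obtain ⟨v, hv, hva⟩ := mem_falseSupport.1 hB.1
    refine ⟨_, hS m hm v hv, fun i hi => ?_⟩
    rcases Finset.mem_insert.1 hi with rfl | hi
    · simp [hva]
    · simp [hmB i hi]

theorem extend_comp_eq_self {n k : ℕ} {e : Fin k → Fin n} (he : Function.Injective e)
    {v : Fin n → Bool} (hv : ∀ i, i ∉ Set.range e → v i = true) :
    Function.extend e (v ∘ e) (fun _ => true) = v := by
  funext i
  by_cases hi : i ∈ Set.range e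
  · obtain ⟨j, rfl⟩ := hi
    simp [he.extend_apply]
  · rw [Function.extend_apply' _ _ _ hi, hv i hi]

/-- Meet-closed sets containing the all-true vector whose false support is the range of an
injection `e : Fin k → Fin n` correspond to meet-closed sets of vectors over `k` variables
containing both constant vectors. -/
def falseSupportFiberEquiv {n k : ℕ} (A : Finset (Fin n)) (e : Fin k → Fin n)
    (he : Function.Injective e) (hA : Set.range e = A) :
    {S : {S : Set (Fin n → Bool) // MeetClosed S ∧ (fun _ => true) ∈ S} //
        falseSupport S.1 = A} ≃
      {T : Set (Fin k → Bool) // MeetClosed T ∧ (fun _ => false) ∈ T ∧ (fun _ => true) ∈ T} where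
  toFun S := ⟨{w | Function.extend e w (fun _ => true) ∈ S.1.1}, by
    obtain ⟨⟨S, hS, ht⟩, hSA⟩ := S
    refine ⟨fun v hv w hw => ?_, ?_, ?_⟩
    · have h := hS _ hv _ hw
      simp only [Set.mem_ofPred_eq]
      convert h using 1
      funext i
      by_cases hi : i ∈ Set.range e
      · obtain ⟨j, rfl⟩ := hi
        simp [he.extend_apply]
      · simp [Function.extend_apply' _ _ _ hi]
    · obtain ⟨m, hm, hmA⟩ := hS.exists_forall_eq_false ⟨_, ht⟩ A hSA.ge
      simp only [Set.mem_ofPred_eq]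
      convert hm using 1
      funext i
      by_cases hi : i ∈ Set.range e
      · have := hmA i (by rw [hA] at hi; exact hi)
        obtain ⟨j, rfl⟩ := hi
        simp [he.extend_apply, this]
      · rw [Function.extend_apply' _ _ _ hi]
        by_contra h
        have : i ∈ falseSupport S := mem_falseSupport.2 ⟨m, hm, by simpa using Ne.symm h⟩
        exact hi (by rw [hA, ← hSA]; exact this)
    · simp only [Set.mem_ofPred_eq]
      convert ht using 1
      exact extend_comp_eq_self he (v := fun _ => true) fun _ _ => rfl⟩
  invFun T := ⟨⟨{v | v ∘ e ∈ T.1 ∧ ∀ i, i ∉ Set.range e → v i = true},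
      fun v hv w hw => ⟨T.2.1 _ hv.1 _ hw.1, fun i hi => by simp [hv.2 i hi, hw.2 i hi]⟩,
      T.2.2.2, fun _ _ => rfl⟩, by
    ext i
    rw [mem_falseSupport, ← Finset.mem_coe, ← hA]
    constructor
    · rintro ⟨v, hv, hvi⟩
      by_contra hi
      simp [hv.2 i hi] at hvi
    · rintro ⟨j, rfl⟩
      refine ⟨Function.extend e (fun _ => false) (fun _ => true), ⟨?_, fun i hi => ?_⟩, ?_⟩
      · rw [Function.extend_comp he]
        exact T.2.2.1
      · rw [Function.extend_apply' _ _ _ hi]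
      · rw [he.extend_apply]⟩
  left_inv S := by
    obtain ⟨⟨S, hS, ht⟩, hSA⟩ := S
    refine Subtype.ext (Subtype.ext (Set.ext fun v => ?_))
    simp only [Set.mem_ofPred_eq]
    constructor
    · rintro ⟨h, hv⟩
      rwa [extend_comp_eq_self he hv] at h
    · intro h
      have hv : ∀ i, i ∉ Set.range e → v i = true := fun i hi => by
        by_contra hvi
        have : i ∈ falseSupport S := mem_falseSupport.2 ⟨v, h, by simpa using hvi⟩
        exact hi (by rw [hA, ← hSA]; exact this)
      exact ⟨by rwa [extend_comp_eq_self he hv], hv⟩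
  right_inv T := by
    refine Subtype.ext (Set.ext fun w => ?_)
    simp only [Set.mem_ofPred_eq, Function.extend_comp he]
    exact and_iff_left fun i hi => Function.extend_apply' _ _ _ hi

theorem card_meetClosed_true_mem (n : ℕ) :
    Nat.card {S : Set (Fin n → Bool) // MeetClosed S ∧ (fun _ => true) ∈ S} =
      ∑ k ∈ Finset.range (n + 1), n.choose k * H k := by
  rw [← Nat.card_congr (Equiv.sigmaFiberEquiv fun S :
      {S : Set (Fin n → Bool) // MeetClosed S ∧ (fun _ => true) ∈ S} => falseSupport S.1),
    Nat.card_sigma]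
  have hfiber (A : Finset (Fin n)) :
      Nat.card {S : {S : Set (Fin n → Bool) // MeetClosed S ∧ (fun _ => true) ∈ S} //
        falseSupport S.1 = A} = H A.card :=
    Nat.card_congr (falseSupportFiberEquiv A (A.orderEmbOfFin rfl)
      (A.orderEmbOfFin rfl).injective (A.range_orderEmbOfFin rfl))
  simp only [hfiber]
  simpa using Finset.sum_powerset_apply_card H (x := (Finset.univ : Finset (Fin n)))

theorem H01_eq_sum_choose_mul_two_mul_H (n : ℕ) :
    Nat.card {S : Set (Fin n → Bool) // MeetClosed S} =
      ∑ k ∈ Finset.range (n + 1), n.choose k * (2 * H k) := by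
  rw [Nat.card_congr (meetClosedEquivBoolProd n), Nat.card_prod, card_meetClosed_true_mem,
    Finset.mul_sum]
  simp [Nat.mul_left_comm]
end

section
/- The number of meet-closed subsets of Fin 5 → Bool containing both the all-false vector and the all-true vector is 1373701. (In the paper's notation: H(5) = 1,373,701.) -/
/-- The natural number with binary digits `f 0, ..., f 7`. -/
def byteOf (f : ℕ → Bool) : ℕ :=
  (List.range 8).foldr (fun u a => Nat.lor (cond (f u) (2 ^ u) 0) a) 0

/-- The codes `u` whose meet with `v` lies in the family `c`. -/
def meetPreimage (c v : ℕ) : ℕ := byteOf fun u => c.testBit (u &&& v)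

/-- The preimages `meetPreimage c v`, each paired with `v`. -/
def preimageTable (c : ℕ) : List (ℕ × ℕ) :=
  (List.range 8).map fun v => (v, meetPreimage c v)

/-- The intersection of the second components of the pairs whose first component
is a member of `b`. -/
noncomputable def interOver (ps : List (ℕ × ℕ)) (b : ℕ) : ℕ :=
  List.rec 255 (fun p _ ih => cond (Nat.beq (Nat.land b (Nat.pow 2 p.1)) 0) ih (Nat.land p.2 ih)) ps

/-- The codes `u` such that the meet of `u` with every member of `b` lies in `c`. -/
noncomputable def meetResidual (b c : ℕ) : ℕ := interOver (preimageTable c) b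

/-- The meet-closed families on three variables, as masks. -/
def closedMasks : List ℕ :=
  [0, 1, 2, 3, 4, 5, 7, 8, 9, 10, 11, 12, 13, 15, 16, 17, 19, 21, 23, 25, 27, 29, 31, 32,
   33, 34, 35, 37, 39, 42, 43, 47, 48, 49, 51, 53, 55, 59, 63, 64, 65, 67, 68, 69, 71, 76,
   77, 79, 80, 81, 83, 85, 87, 93, 95, 112, 113, 115, 117, 119, 127, 128, 129, 130, 131,
   132, 133, 135, 136, 137, 138, 139, 140, 141, 143, 144, 145, 147, 149, 151, 153, 155,
   157, 159, 160, 161, 162, 163, 165, 167, 170, 171, 175, 176, 177, 179, 181, 183, 187,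
   191, 192, 193, 195, 196, 197, 199, 204, 205, 207, 208, 209, 211, 213, 215, 221, 223,
   240, 241, 243, 245, 247, 255]

/-- The packed table whose `m`-th byte is the number of meet-closed families that contain the
top vector and are contained in `m`. -/
def mooreTable : ℕ :=
  7708488228021907286160003452547548244336322843884221737762711095071637975486686739496994265094571696725731836099922719206963150802853293986318631986662276918227718167578817057195954693913491765011389985347931656109778983671232124311199705131346799326633331962999504020731939521092429221228425866082027185400662738412033918640166355579706419820923074669413348436021391878267868371999389634401476128180137434751575908536301500786569011400844595876331153778711446348965405372893488850687253087105244802667282688396680617496765208637537641510716316350990191524857878320909828969708161180848189163977463514912964017651712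

/-- The `m`-th byte of `mooreTable`. -/
def mooreCount (m : ℕ) : ℕ := Nat.land (Nat.shiftRight mooreTable (Nat.mul 8 m)) 255

/-- Application of `k` to `n` that makes the kernel evaluate `n` first. -/
noncomputable def force {α : Type} (n : ℕ) (k : ℕ → α) : α :=
  Nat.rec (k 0) (fun m _ => k (Nat.succ m)) n

/-- `List.map` with evaluated values, in continuation-passing style, paired with the arguments. -/
noncomputable def forceGraph {α : Type} (f : ℕ → ℕ) (l : List ℕ) (k : List (ℕ × ℕ) → α) : α :=
  List.rec (fun acc => k acc)
    (fun x _ ih acc => force (f x) fun s => ih ((x, s) :: acc)) l []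

/-- The pairs of `l` with first component contained in `s`, in reverse order and with second
component intersected with `s`, in continuation-passing style. -/
noncomputable def forceRestrict {α : Type} (s : ℕ) (l : List (ℕ × ℕ))
    (k : List (ℕ × ℕ) → α) : α :=
  List.rec (fun acc => k acc)
    (fun p _ ih acc => cond (Nat.beq (Nat.land p.1 s) p.1)
      (force (Nat.land s p.2) fun t => ih ((p.1, t) :: acc)) (ih acc)) l []

/-- `List.sum` of `List.map`, in a form suited to evaluation by the kernel. -/
noncomputable def sumOver {α : Type} (f : α → ℕ) (l : List α) : ℕ :=
  List.rec 0 (fun a _ ih => Nat.add (f a) ih) l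

/-- The number of meet-closed families on five variables with prescribed slice `c`. -/
noncomputable def sliceCount (stab : List (ℕ × ℕ)) (c : ℕ) : ℕ :=
  forceGraph (meetPreimage c) (List.range 8) fun ps =>
    force (interOver ps c) fun s =>
      forceRestrict s stab fun l =>
        sumOver (fun p => force (interOver ps p.1) fun r =>
          sumOver (fun q => cond (Nat.beq (Nat.land q.1 r) q.1)
            (mooreCount (Nat.land p.2 q.2)) 0) l) l

/-- The number of meet-closed families on five variables that contain bottom and top. -/
noncomputable def totalCount : ℕ :=
  forceGraph (fun x => meetResidual x x) closedMasks fun stab =>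
    sumOver (fun c => cond (Nat.beq (Nat.land c 1) 0) 0 (sliceCount stab c)) closedMasks

theorem totalCount_eq : totalCount = 1373701 := by
  decide +kernel


theorem testBit_byteOf (f : ℕ → Bool) {u : ℕ} (hu : u < 8) : (byteOf f).testBit u = f u := by
  have key : ∀ l : List ℕ, (l.foldr (fun u a => Nat.lor (cond (f u) (2 ^ u) 0) a) 0).testBit u =
      (decide (u ∈ l) && f u) := by
    intro l
    induction l with
    | nil => simp
    | cons v l ih =>
      have h : Nat.lor (cond (f v) (2 ^ v) 0)
          (l.foldr (fun u a => Nat.lor (cond (f u) (2 ^ u) 0) a) 0) =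
          (cond (f v) (2 ^ v) 0) |||
          (l.foldr (fun u a => Nat.lor (cond (f u) (2 ^ u) 0) a) 0) := rfl
      rw [List.foldr_cons, h, Nat.testBit_or, ih]
      by_cases huv : v = u
      · subst huv
        cases f v <;> simp
      · have huv' : ¬u = v := fun h => huv h.symm
        cases f v <;> simp [huv, huv']
  rw [byteOf, key]
  simp [hu]

theorem beq_land_two_pow (b v : ℕ) : Nat.beq (Nat.land b (Nat.pow 2 v)) 0 = !b.testBit v := by
  have h : Nat.land b (Nat.pow 2 v) = (b.testBit v).toNat * 2 ^ v := Nat.and_two_pow b v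
  rw [h, Bool.eq_iff_iff, Nat.beq_eq]
  cases b.testBit v <;> simp

theorem testBit_interOver (ps : List (ℕ × ℕ)) (b : ℕ) {u : ℕ} (hu : u < 8) :
    (interOver ps b).testBit u = true ↔
      ∀ p ∈ ps, b.testBit p.1 = true → p.2.testBit u = true := by
  induction ps with
  | nil =>
    have : ∀ u < 8, Nat.testBit 255 u = true := by decide
    simpa [interOver] using this u hu
  | cons p ps ih =>
    have h : interOver (p :: ps) b = cond (Nat.beq (Nat.land b (Nat.pow 2 p.1)) 0)
      (interOver ps b) (p.2 &&& interOver ps b) := rfl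
    rw [h, beq_land_two_pow, List.forall_mem_cons, ← ih]
    cases b.testBit p.1 <;> simp

theorem interOver_lt (ps : List (ℕ × ℕ)) (b : ℕ) : interOver ps b < 256 := by
  induction ps with
  | nil => simp [interOver]
  | cons p ps ih =>
    have h : interOver (p :: ps) b = cond (Nat.beq (Nat.land b (Nat.pow 2 p.1)) 0)
      (interOver ps b) (p.2 &&& interOver ps b) := rfl
    rw [h]
    cases Nat.beq (Nat.land b (Nat.pow 2 p.1)) 0
    · exact lt_of_le_of_lt Nat.and_le_right ih
    · exact ih

/-- All meets of a member of `a` and a member of `b` lie in `c`. -/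
def MeetsInto (a b c : ℕ) : Prop :=
  ∀ u < 8, ∀ v < 8, a.testBit u = true → b.testBit v = true → c.testBit (u &&& v) = true

instance (a b c : ℕ) : Decidable (MeetsInto a b c) :=
  inferInstanceAs (Decidable (∀ u < 8, ∀ v < 8, _ → _ → _))

theorem testBit_meetResidual (b c : ℕ) {u : ℕ} (hu : u < 8) :
    (meetResidual b c).testBit u = true ↔
      ∀ v < 8, b.testBit v = true → c.testBit (u &&& v) = true := by
  rw [meetResidual, testBit_interOver _ _ hu]
  simp [preimageTable, meetPreimage, testBit_byteOf _ hu]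

theorem land_eq_left_iff {a : ℕ} (ha : a < 256) (b : ℕ) :
    a &&& b = a ↔ ∀ u < 8, a.testBit u = true → b.testBit u = true := by
  constructor
  · intro h u _ hau
    rw [← h, Nat.testBit_and] at hau
    simp_all
  · intro h
    refine Nat.eq_of_testBit_eq fun u => ?_
    rw [Nat.testBit_and]
    by_cases hu : u < 8
    · have := h u hu
      cases hau : a.testBit u <;> simp_all
    · have : a.testBit u = false := Nat.testBit_lt_two_pow
        (lt_of_lt_of_le ha (Nat.pow_le_pow_right (n := 2) (by norm_num) (by omega : 8 ≤ u)))
      simp [this]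

theorem land_meetResidual_eq_iff {a : ℕ} (ha : a < 256) (b c : ℕ) :
    a &&& meetResidual b c = a ↔ MeetsInto a b c := by
  rw [land_eq_left_iff ha, MeetsInto]
  refine forall₂_congr fun u hu => ?_
  rw [testBit_meetResidual b c hu]
  tauto

theorem land_land_eq_left_iff (a b c : ℕ) : a &&& (b &&& c) = a ↔ a &&& b = a ∧ a &&& c = a := by
  constructor
  · intro h
    constructor <;> rw [← h] <;> refine Nat.eq_of_testBit_eq fun u => ?_ <;>
      simp only [Nat.testBit_and] <;> cases a.testBit u <;> cases b.testBit u <;>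
      cases c.testBit u <;> rfl
  · rintro ⟨h, h'⟩
    rw [← Nat.and_assoc, h, h']

theorem MeetsInto.comm {a b c : ℕ} (h : MeetsInto a b c) : MeetsInto b a c := by
  intro u hu v hv ha hb
  rw [Nat.and_comm]
  exact h v hv u hu hb ha

theorem closedMasks_toFinset :
    closedMasks.toFinset = {a ∈ Finset.range 256 | MeetsInto a a a} := by
  have h : closedMasks.toFinset = {a ∈ Finset.range 256 | a &&& meetResidual a a = a} := by
    decide +kernel
  rw [h]
  refine Finset.filter_congr fun a ha => ?_
  exact land_meetResidual_eq_iff (Finset.mem_range.1 ha) a a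

theorem closedMasks_nodup : closedMasks.Nodup := by decide +kernel

theorem mooreCount_eq {m : ℕ} (hm : m < 256) :
    mooreCount m = ∑ d ∈ closedMasks.toFinset,
      if d.testBit 7 = true ∧ d &&& m = d then 1 else 0 := by
  have h : ∀ m < 256, mooreCount m =
      (closedMasks.map fun d => if d.testBit 7 = true ∧ d &&& m = d then 1 else 0).sum := by
    decide +kernel
  rw [h m hm, List.sum_toFinset _ closedMasks_nodup]

theorem force_eq {α : Type} (n : ℕ) (k : ℕ → α) : force n k = k n := by
  cases n <;> rfl

theorem forceGraph_eq {α : Type} (f : ℕ → ℕ) (l : List ℕ) (k : List (ℕ × ℕ) → α) :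
    forceGraph f l k = k (l.map fun x => (x, f x)).reverse := by
  have key : ∀ acc : List (ℕ × ℕ),
      (List.rec (fun acc => k acc) (fun x _ ih acc => force (f x) fun s => ih ((x, s) :: acc)) l :
        List (ℕ × ℕ) → α) acc = k ((l.map fun x => (x, f x)).reverse ++ acc) := by
    induction l with
    | nil => simp
    | cons x l ih =>
      intro acc
      refine (force_eq (f x) _).trans ((ih _).trans ?_)
      simp
  exact (key []).trans (by rw [List.append_nil])

theorem cond_beq {α : Type} (a b : ℕ) (x y : α) :
    cond (Nat.beq a b) x y = if a = b then x else y := by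
  by_cases h : a = b
  · simp [h]
  · have : Nat.beq a b = false := by rw [Bool.eq_false_iff, ne_eq, Nat.beq_eq]; exact h
    rw [this, if_neg h]; rfl

theorem forceRestrict_eq {α : Type} (s : ℕ) (l : List (ℕ × ℕ)) (k : List (ℕ × ℕ) → α) :
    forceRestrict s l k =
      k ((l.filter fun p => p.1 &&& s = p.1).map fun p => (p.1, s &&& p.2)).reverse := by
  have key : ∀ acc : List (ℕ × ℕ),
      (List.rec (fun acc => k acc) (fun p _ ih acc => cond (Nat.beq (Nat.land p.1 s) p.1)
        (force (Nat.land s p.2) fun t => ih ((p.1, t) :: acc)) (ih acc)) l :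
        List (ℕ × ℕ) → α) acc =
      k (((l.filter fun p => p.1 &&& s = p.1).map fun p => (p.1, s &&& p.2)).reverse ++ acc) := by
    induction l with
    | nil => simp
    | cons p l ih =>
      intro acc
      refine (cond_beq (p.1 &&& s) p.1 _ _).trans ?_
      by_cases hp : p.1 &&& s = p.1
      · rw [if_pos hp]
        refine (force_eq (s &&& p.2) _).trans ((ih _).trans ?_)
        simp [hp]
      · rw [if_neg hp]
        refine (ih _).trans ?_
        simp [hp]
  exact (key []).trans (by rw [List.append_nil])

theorem sumOver_eq {α : Type} (f : α → ℕ) (l : List α) : sumOver f l = (l.map f).sum := by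
  induction l with
  | nil => rfl
  | cons a l ih => rw [List.map_cons, List.sum_cons, ← ih]; rfl

theorem interOver_reverse (ps : List (ℕ × ℕ)) (b : ℕ) :
    interOver ps.reverse b = interOver ps b := by
  refine Nat.eq_of_testBit_eq fun u => ?_
  by_cases hu : u < 8
  · rw [Bool.eq_iff_iff, testBit_interOver _ _ hu, testBit_interOver _ _ hu]
    simp
  · have h (ps) : (interOver ps b).testBit u = false := Nat.testBit_lt_two_pow
      (lt_of_lt_of_le (interOver_lt ps b)
        (Nat.pow_le_pow_right (n := 2) (by norm_num) (by omega : 8 ≤ u)))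
    rw [h, h]

theorem sliceCount_eq (c : ℕ) :
    sliceCount (closedMasks.map fun x => (x, meetResidual x x)).reverse c =
      ∑ x ∈ closedMasks.toFinset, if x &&& meetResidual c c = x then
        ∑ y ∈ closedMasks.toFinset, if y &&& meetResidual c c = y then
          if y &&& meetResidual x c = y then
            mooreCount ((meetResidual c c &&& meetResidual x x) &&&
              (meetResidual c c &&& meetResidual y y))
          else 0 else 0 else 0 := by
  have hres (b : ℕ) : interOver ((List.range 8).map fun x => (x, meetPreimage c x)).reverse b =
      meetResidual b c := by
    rw [interOver_reverse]; rfl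
  have hsum (g : ℕ × ℕ → ℕ) (s : ℕ) :
      sumOver g ((((closedMasks.map fun x => (x, meetResidual x x)).reverse.filter
        fun p => p.1 &&& s = p.1).map fun p => (p.1, s &&& p.2)).reverse) =
      ∑ x ∈ closedMasks.toFinset, if x &&& s = x then g (x, s &&& meetResidual x x) else 0 := by
    simp only [List.filter_reverse, List.map_reverse, List.reverse_reverse]
    have ht : {a ∈ closedMasks.toFinset | a &&& s = a} =
        (closedMasks.filter fun a => a &&& s = a).toFinset := by
      ext a
      simp only [Finset.mem_filter, List.mem_toFinset, List.mem_filter, decide_eq_true_eq]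
    rw [sumOver_eq, ← Finset.sum_filter, List.filter_map, ht,
      List.sum_toFinset _ (closedMasks_nodup.filter _), List.map_map, List.map_map]
    rfl
  have hl (a b : ℕ) : Nat.land a b = a &&& b := rfl
  simp only [sliceCount, forceGraph_eq, force_eq, hres, forceRestrict_eq, hsum, hl, cond_beq]

theorem totalCount_eq_sum :
    totalCount = ∑ c ∈ closedMasks.toFinset, if c &&& 1 = 0 then 0 else
      sliceCount (closedMasks.map fun x => (x, meetResidual x x)).reverse c := by
  rw [totalCount, forceGraph_eq, sumOver_eq, List.sum_toFinset _ closedMasks_nodup]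
  exact congrArg List.sum (List.map_congr_left fun c _ => cond_beq _ _ _ _)

/-- The compatibility conditions on the four slices of a meet-closed family on five variables
that contains bottom and top. -/
def CompatibleSlices (c x y d : ℕ) : Prop :=
  (MeetsInto c c c ∧ c.testBit 0 = true) ∧ (MeetsInto x x x ∧ MeetsInto x c c) ∧
  (MeetsInto y y y ∧ MeetsInto y c c ∧ MeetsInto y x c) ∧
  (MeetsInto d d d ∧ d.testBit 7 = true ∧ MeetsInto d c c ∧ MeetsInto d x x ∧ MeetsInto d y y)

open Classical in
theorem totalCount_eq_sum_compatibleSlices :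
    totalCount = ∑ c ∈ Finset.range 256, ∑ x ∈ Finset.range 256, ∑ y ∈ Finset.range 256,
      ∑ d ∈ Finset.range 256, if CompatibleSlices c x y d then 1 else 0 := by
  rw [totalCount_eq_sum]
  simp only [sliceCount_eq]
  simp only [closedMasks_toFinset, Finset.sum_filter]
  refine Finset.sum_congr rfl fun c hc => ?_
  have hc0 : c &&& 1 = 0 ↔ ¬c.testBit 0 = true := by
    simp [Nat.testBit_zero, Nat.and_one_is_mod]
  by_cases h₁ : MeetsInto c c c ∧ c.testBit 0 = true
  swap
  · trans 0
    · by_cases h : MeetsInto c c c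
      · rw [if_pos h, if_pos (hc0.2 fun h' => h₁ ⟨h, h'⟩)]
      · rw [if_neg h]
    · exact (Finset.sum_eq_zero fun _ _ => Finset.sum_eq_zero fun _ _ =>
        Finset.sum_eq_zero fun _ _ => if_neg fun h => h₁ h.1).symm
  rw [if_pos h₁.1, if_neg fun h => hc0.1 h h₁.2]
  refine Finset.sum_congr rfl fun x hx => ?_
  rw [← ite_and]
  simp only [land_meetResidual_eq_iff (Finset.mem_range.1 hx)]
  by_cases h₂ : MeetsInto x x x ∧ MeetsInto x c c
  swap
  · rw [if_neg h₂]
    exact (Finset.sum_eq_zero fun _ _ => Finset.sum_eq_zero fun _ _ =>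
      if_neg fun h => h₂ h.2.1).symm
  rw [if_pos h₂]
  refine Finset.sum_congr rfl fun y hy => ?_
  rw [← ite_and, ← ite_and]
  simp only [land_meetResidual_eq_iff (Finset.mem_range.1 hy)]
  by_cases h₃ : MeetsInto y y y ∧ MeetsInto y c c ∧ MeetsInto y x c
  swap
  · rw [if_neg (by tauto)]
    exact (Finset.sum_eq_zero fun _ _ => if_neg fun h => h₃ h.2.2.1).symm
  rw [if_pos (by tauto), mooreCount_eq, closedMasks_toFinset, Finset.sum_filter]
  · refine Finset.sum_congr rfl fun d hd => ?_
    rw [← ite_and]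
    refine if_congr ?_ rfl rfl
    simp only [land_land_eq_left_iff, land_meetResidual_eq_iff (Finset.mem_range.1 hd),
      CompatibleSlices, h₁, h₂, h₃]
    tauto
  · exact lt_of_le_of_lt Nat.and_le_left
      (lt_of_le_of_lt Nat.and_le_left (interOver_lt _ _))

/-- The number whose binary digits are the first three coordinates of `v`. -/
def lowCode (v : Fin 5 → Bool) : ℕ := (v 0).toNat + 2 * (v 1).toNat + 4 * (v 2).toNat

/-- The mask among `c`, `x`, `y`, `d` selected by the last two coordinates. -/
def selectSlice (c x y d : ℕ) (p q : Bool) : ℕ := cond p (cond q d y) (cond q x c)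

/-- The family on five variables with the given four slices. -/
def familyOfSlices (c x y d : ℕ) : Set (Fin 5 → Bool) :=
  {v | (selectSlice c x y d (v 3) (v 4)).testBit (lowCode v) = true}

theorem lowCode_lt (v : Fin 5 → Bool) : lowCode v < 8 := by
  unfold lowCode
  cases v 0 <;> cases v 1 <;> cases v 2 <;> decide

theorem lowCode_inf (v w : Fin 5 → Bool) :
    lowCode (fun i => v i && w i) = lowCode v &&& lowCode w := by
  have h : ∀ a b c a' b' c' : Bool,
      (a && a').toNat + 2 * (b && b').toNat + 4 * (c && c').toNat =
      (a.toNat + 2 * b.toNat + 4 * c.toNat) &&& (a'.toNat + 2 * b'.toNat + 4 * c'.toNat) := by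
    decide
  exact h _ _ _ _ _ _

theorem exists_lowCode_eq (p q : Bool) {u : ℕ} (hu : u < 8) :
    ∃ v : Fin 5 → Bool, v 3 = p ∧ v 4 = q ∧ lowCode v = u := by
  refine ⟨![u.testBit 0, u.testBit 1, u.testBit 2, p, q], rfl, rfl, ?_⟩
  simp only [lowCode]
  interval_cases u <;> rfl

theorem meetClosed_familyOfSlices_iff (c x y d : ℕ) :
    MeetClosed (familyOfSlices c x y d) ↔ ∀ p q p' q' : Bool,
      MeetsInto (selectSlice c x y d p q) (selectSlice c x y d p' q')
        (selectSlice c x y d (p && p') (q && q')) := by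
  constructor
  · intro h p q p' q' u hu v hv hpu hqv
    obtain ⟨a, rfl, rfl, rfl⟩ := exists_lowCode_eq p q hu
    obtain ⟨b, rfl, rfl, rfl⟩ := exists_lowCode_eq p' q' hv
    rw [← lowCode_inf]
    exact h a hpu b hqv
  · intro h a ha b hb
    have := h _ _ _ _ _ (lowCode_lt a) _ (lowCode_lt b) ha hb
    rwa [← lowCode_inf] at this

theorem compatibleSlices_iff (c x y d : ℕ) :
    (MeetClosed (familyOfSlices c x y d) ∧ (fun _ => false) ∈ familyOfSlices c x y d ∧
      (fun _ => true) ∈ familyOfSlices c x y d) ↔ CompatibleSlices c x y d := by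
  rw [meetClosed_familyOfSlices_iff]
  constructor
  · rintro ⟨h, h0, h1⟩
    exact ⟨⟨h false false false false, h0⟩, ⟨h false true false true, h false true false false⟩,
      ⟨h true false true false, h true false false false, h true false false true⟩,
      h true true true true, h1, h true true false false, h true true false true,
      h true true true false⟩
  · rintro ⟨⟨hc, h0⟩, ⟨hx, hxc⟩, ⟨hy, hyc, hyx⟩, hd, h1, hdc, hdx, hdy⟩
    refine ⟨?_, h0, h1⟩
    rintro (_ | _) (_ | _) (_ | _) (_ | _)
    exacts [hc, hxc.comm, hyc.comm, hdc.comm, hxc, hx, hyx.comm, hdx.comm,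
      hyc, hyx, hy, hdy.comm, hdc, hdx, hdy, hd]

theorem familyOfSlices_bijective :
    Function.Bijective fun s : Fin 256 × Fin 256 × Fin 256 × Fin 256 =>
      familyOfSlices s.1 s.2.1 s.2.2.1 s.2.2.2 := by
  refine (Nat.bijective_iff_injective_and_card _).2 ⟨?_, ?_⟩
  · rintro ⟨c, x, y, d⟩ ⟨c', x', y', d'⟩ h
    have key (p q : Bool) (a b : Fin 256) (ha : selectSlice c x y d p q = a)
        (hb : selectSlice c' x' y' d' p q = b) : a = b := by
      refine Fin.ext (Nat.eq_of_testBit_eq fun u => ?_)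
      by_cases hu : u < 8
      · obtain ⟨v, rfl, rfl, rfl⟩ := exists_lowCode_eq p q hu
        rw [← ha, ← hb, Bool.eq_iff_iff]
        exact Set.ext_iff.1 h v
      · have hz (a : Fin 256) : (a : ℕ).testBit u = false := Nat.testBit_lt_two_pow
          (lt_of_lt_of_le a.2
            (Nat.pow_le_pow_right (n := 2) (by norm_num) (by omega : 8 ≤ u)))
        rw [hz, hz]
    rw [key false false c c' rfl rfl, key false true x x' rfl rfl,
      key true false y y' rfl rfl, key true true d d' rfl rfl]
  · simp [Nat.card_eq_fintype_card]

theorem H_5_eq :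
    Nat.card {S : Set (Fin 5 → Bool) //
        MeetClosed S ∧ (fun _ => false) ∈ S ∧ (fun _ => true) ∈ S} = 1373701 := by
  classical
  have e : {s : Fin 256 × Fin 256 × Fin 256 × Fin 256 //
      CompatibleSlices s.1 s.2.1 s.2.2.1 s.2.2.2} ≃ {S : Set (Fin 5 → Bool) //
        MeetClosed S ∧ (fun _ => false) ∈ S ∧ (fun _ => true) ∈ S} :=
    (Equiv.ofBijective _ familyOfSlices_bijective).subtypeEquiv fun s =>
      (compatibleSlices_iff s.1 s.2.1 s.2.2.1 s.2.2.2).symm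
  rw [← Nat.card_congr e, Nat.card_eq_fintype_card, Fintype.card_subtype, Finset.card_filter,
    ← totalCount_eq, totalCount_eq_sum_compatibleSlices]
  simp only [Fintype.sum_prod_type, Finset.sum_range]
end

section
/- The number of meet-closed subsets of Fin 4 → Bool containing the all-true vector is 2480. (In the paper's notation: H₁(4) = 2480, the number of Moore families on a 4-element set.) -/
/-- The sets of natural numbers that are closed under bitwise conjunction and agree with `T`
from `k` on. -/
def landClosedExtending (k : ℕ) (T : List ℕ) : Set (Set ℕ) :=
  {S | (∀ v ∈ S, ∀ w ∈ S, v &&& w ∈ S) ∧ ∀ x, k ≤ x → (x ∈ S ↔ x ∈ T)}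

/-- Counts the members of `landClosedExtending k T` by deciding the membership of
`k - 1, …, 0` in this order: a number may be left out unless it is a conjunction of two
numbers already chosen. -/
def countLandClosed : ℕ → List ℕ → ℕ
  | 0, _ => 1
  | k + 1, T => countLandClosed k (k :: T) +
      bif T.any fun v => T.any fun w => Nat.beq (Nat.land v w) k then 0
      else countLandClosed k T

theorem landClosedExtending_succ {k : ℕ} {T : List ℕ} (hT : ∀ x ∈ T, k < x) :
    landClosedExtending (k + 1) T =
      landClosedExtending k (k :: T) ∪ landClosedExtending k T := by
  have hk : k ∉ T := fun h => (hT k h).false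
  ext S
  simp only [landClosedExtending, Set.mem_union, Set.mem_ofPred_eq, List.mem_cons]
  constructor
  · rintro ⟨hS, h⟩
    by_cases hkS : k ∈ S
    · refine .inl ⟨hS, fun x hx => ?_⟩
      rcases hx.eq_or_lt with rfl | hx
      · simp [hkS]
      · simp [h x hx, hx.ne']
    · refine .inr ⟨hS, fun x hx => ?_⟩
      rcases hx.eq_or_lt with rfl | hx
      · simp [hkS, hk]
      · exact h x hx
  · rintro (⟨hS, h⟩ | ⟨hS, h⟩)
    · refine ⟨hS, fun x hx => ?_⟩
      have hxk : x ≠ k := by omega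
      simpa [hxk] using h x (by omega)
    · exact ⟨hS, fun x hx => h x (by omega)⟩

theorem disjoint_landClosedExtending {k : ℕ} {T : List ℕ} (hk : k ∉ T) :
    Disjoint (landClosedExtending k (k :: T)) (landClosedExtending k T) := by
  rw [Set.disjoint_left]
  rintro S ⟨-, h⟩ ⟨-, h'⟩
  exact hk ((h' k le_rfl).1 ((h k le_rfl).2 List.mem_cons_self))

theorem encard_landClosedExtending (k : ℕ) (T : List ℕ) (hT : ∀ x ∈ T, k ≤ x)
    (hcl : ∀ v ∈ T, ∀ w ∈ T, v &&& w ∈ T ∨ v &&& w < k) :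
    (landClosedExtending k T).encard = countLandClosed k T := by
  induction k generalizing T with
  | zero =>
    have : landClosedExtending 0 T = {{x | x ∈ T}} := by
      ext S
      simp only [landClosedExtending, Set.mem_ofPred_eq, Set.mem_singleton_iff]
      constructor
      · rintro ⟨-, h⟩
        ext x
        exact h x x.zero_le
      · rintro rfl
        exact ⟨fun v hv w hw => (hcl v hv w hw).resolve_right (Nat.not_lt_zero _),
          fun _ _ => Iff.rfl⟩
    simp [this, countLandClosed]
  | succ k ih =>
    have hk : k ∉ T := fun h => (hT k h).not_gt k.lt_succ_self
    have h_incl : (landClosedExtending k (k :: T)).encard = countLandClosed k (k :: T) := by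
      refine ih _ ?_ ?_
      · rintro x (_ | ⟨_, hx⟩)
        · exact le_rfl
        · exact (Nat.le_succ k).trans (hT x hx)
      · intro v hv w hw
        have hor : ∀ x, x ≤ k → x ∈ k :: T ∨ x < k := fun x hx =>
          hx.eq_or_lt.imp_left fun h => List.mem_cons.2 (.inl h)
        rcases List.mem_cons.1 hv with rfl | hv
        · exact hor _ Nat.and_le_left
        rcases List.mem_cons.1 hw with rfl | hw
        · exact hor _ Nat.and_le_right
        rcases hcl v hv w hw with h | h
        · exact .inl (List.mem_cons_of_mem _ h)
        · exact hor _ (Nat.lt_succ_iff.1 h)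
    rw [landClosedExtending_succ hT, Set.encard_union_eq (disjoint_landClosedExtending hk),
      h_incl, countLandClosed, Nat.cast_add]
    congr 1
    cases hb : T.any fun v => T.any fun w => Nat.beq (Nat.land v w) k with
    | true =>
      obtain ⟨v, hv, w, hw, hvw⟩ : ∃ v ∈ T, ∃ w ∈ T, v &&& w = k := by
        simp only [List.any_eq_true, Nat.beq_eq] at hb
        exact hb
      have : landClosedExtending k T = ∅ := by
        refine Set.eq_empty_of_forall_notMem fun S ⟨hS, h⟩ => hk ((h k le_rfl).1 ?_)
        have hmem : ∀ x ∈ T, x ∈ S := fun x hx =>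
          (h x ((Nat.le_succ k).trans (hT x hx))).2 hx
        exact hvw ▸ hS v (hmem v hv) w (hmem w hw)
      simp [this]
    | false =>
      have hne : ∀ v ∈ T, ∀ w ∈ T, v &&& w ≠ k := by
        intro v hv w hw hvw
        refine Bool.false_ne_true (hb.symm.trans ?_)
        simp only [List.any_eq_true, Nat.beq_eq]
        exact ⟨v, hv, w, hw, hvw⟩
      exact ih T (fun x hx => (Nat.le_succ k).trans (hT x hx)) fun v hv w hw =>
        (hcl v hv w hw).imp_right fun h =>
          lt_of_le_of_ne (Nat.lt_succ_iff.1 h) (hne v hv w hw)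

theorem ofBits_and {n : ℕ} (v w : Fin n → Bool) :
    Nat.ofBits (fun i => v i && w i) = Nat.ofBits v &&& Nat.ofBits w := by
  refine Nat.eq_of_testBit_eq fun i => ?_
  rw [Nat.testBit_and]
  by_cases hi : i < n
  · simp [Nat.testBit_ofBits_lt _ _ hi]
  · simp [Nat.testBit_ofBits_ge _ _ (not_lt.1 hi)]

theorem ofBits_injective (n : ℕ) : Function.Injective (Nat.ofBits (n := n)) := by
  intro v w h
  ext i
  rw [← Nat.testBit_ofBits_lt v i i.2, h, Nat.testBit_ofBits_lt]

theorem exists_ofBits_eq {n x : ℕ} (hx : x < 2 ^ n) : ∃ v : Fin n → Bool, Nat.ofBits v = x :=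
  ⟨fun i => x.testBit i, by rw [Nat.ofBits_testBit, Nat.mod_eq_of_lt hx]⟩

theorem ofBits_true (n : ℕ) : Nat.ofBits (fun _ : Fin n => true) = 2 ^ n - 1 := by
  refine Nat.eq_of_testBit_eq fun i => ?_
  rw [Nat.testBit_two_pow_sub_one]
  by_cases hi : i < n
  · simp [Nat.testBit_ofBits_lt _ _ hi, hi]
  · simp [Nat.testBit_ofBits_ge _ _ (not_lt.1 hi), hi]

theorem image_ofBits_meetClosed (n : ℕ) :
    Set.image Nat.ofBits '' {S : Set (Fin n → Bool) | MeetClosed S ∧ (fun _ => true) ∈ S} =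
      landClosedExtending (2 ^ n - 1) [2 ^ n - 1] := by
  ext R
  constructor
  · rintro ⟨S, ⟨hS, htop⟩, rfl⟩
    refine ⟨?_, fun x hx => ?_⟩
    · rintro _ ⟨v, hv, rfl⟩ _ ⟨w, hw, rfl⟩
      exact ⟨_, hS v hv w hw, ofBits_and v w⟩
    · rw [List.mem_singleton]
      constructor
      · rintro ⟨v, -, rfl⟩
        have := Nat.ofBits_lt_two_pow v
        omega
      · rintro rfl
        exact ⟨_, htop, ofBits_true n⟩
  · rintro ⟨hR, h⟩
    refine ⟨Nat.ofBits ⁻¹' R, ⟨fun v hv w hw => ?_, ?_⟩, ?_⟩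
    · rw [Set.mem_preimage, ofBits_and]
      exact hR _ hv _ hw
    · rw [Set.mem_preimage, ofBits_true, h _ le_rfl, List.mem_singleton]
    · refine Set.image_preimage_eq_of_subset fun x hx => exists_ofBits_eq ?_
      by_contra! hle
      have := List.mem_singleton.1 ((h x ((Nat.sub_le _ 1).trans hle)).1 hx)
      have := Nat.two_pow_pos n
      omega

/-- The number of Moore families on an `n`-element set is computed by `countLandClosed`. -/
theorem card_meetClosed_eq_countLandClosed (n : ℕ) :
    Nat.card {S : Set (Fin n → Bool) // MeetClosed S ∧ (fun _ => true) ∈ S} =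
      countLandClosed (2 ^ n - 1) [2 ^ n - 1] := by
  change Set.ncard {S : Set (Fin n → Bool) | MeetClosed S ∧ (fun _ => true) ∈ S} = _
  rw [← Set.ncard_image_of_injective _ (ofBits_injective n).image_injective,
    image_ofBits_meetClosed, Set.ncard_def,
    encard_landClosedExtending _ _ (fun _ hx => (List.mem_singleton.1 hx).ge) (by simp),
    ENat.toNat_natCast]

theorem H1_4_eq :
    Nat.card {S : Set (Fin 4 → Bool) //
        MeetClosed S ∧ (fun _ => true) ∈ S} = 2480 := by
  rw [card_meetClosed_eq_countLandClosed]
  decide +kernel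
end
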